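/- Let 𝒫 be the subalgebra of 𝒪_q(Mat_n) generated by the elements x_{ij} := Σ_{k=1}^{n} t_{ik} t_{jk} (1 ≤ i,j ≤ n). The ordered monomials x_{11}^{m_{11}} x_{12}^{m_{12}} ⋯ x_{1n}^{m_{1n}} x_{22}^{m_{22}} x_{23}^{m_{23}} ⋯ x_{2n}^{m_{2n}} ⋯ x_{n−1,n−1}^{m_{n−1,n−1}} x_{n−1,n}^{m_{n−1,n}} x_{nn}^{m_{nn}}, in which the factors x_{ij} with i ≤ j appear in lexicographic order of (i,j) and the exponents m_{ij} range over the nonnegative integers, form a k-vector-space basis of 𝒫; the monomials with the factors in the reversed order also form a k-basis of 𝒫. -/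

import Mathlib

open scoped BigOperators TensorProduct

noncomputable section

abbrev K : Type := RatFunc ℂ

def q : K := RatFunc.X

/-- the generator `t_{ij}` of the free algebra -/
def Tg {n : ℕ} (i j : Fin n) : FreeAlgebra K (Fin n × Fin n) := FreeAlgebra.ι K (i, j)

/-- defining relations of `𝒪_q(Mat_n)` -/
inductive matRel (n : ℕ) :
    FreeAlgebra K (Fin n × Fin n) → FreeAlgebra K (Fin n × Fin n) → Prop
  | rowq (l i j : Fin n) (h : i < j) :
      matRel n (Tg l i * Tg l j) (q • (Tg l j * Tg l i))
  | colq (l i j : Fin n) (h : i < j) :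
      matRel n (Tg i l * Tg j l) (q • (Tg j l * Tg i l))
  | anti (i k j l : Fin n) (h1 : i < k) (h2 : j < l) :
      matRel n (Tg i l * Tg k j) (Tg k j * Tg i l)
  | main (i k j l : Fin n) (h1 : i < k) (h2 : j < l) :
      matRel n (Tg i j * Tg k l) (Tg k l * Tg i j + (q - q⁻¹) • (Tg k j * Tg i l))

/-- the quantized function algebra `𝒪_q(Mat_n)` -/
abbrev OqMat (n : ℕ) := RingQuot (matRel n)

/-- the generator `t_{ij}` of `𝒪_q(Mat_n)` -/
def tGen {n : ℕ} (i j : Fin n) : OqMat n :=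
  RingQuot.mkAlgHom K (matRel n) (Tg i j)

/-- the Type AI quantum symmetric matrix generators `x_{ij} = Σ_k t_{ik} t_{jk}` -/
def xAI {n : ℕ} (i j : Fin n) : OqMat n := ∑ k : Fin n, tGen i k * tGen j k

/-- list of upper-triangular index pairs `(i,j)`, `i ≤ j`, in lexicographic order -/
def pairListAI (n : ℕ) : List (Fin n × Fin n) :=
  (List.finRange n).flatMap fun i =>
    ((List.finRange n).filter fun j => decide (i ≤ j)).map fun j => (i, j)

/-- the ordered monomial `x_{11}^{m_{11}} x_{12}^{m_{12}} ⋯ x_{nn}^{m_{nn}}` -/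
def monoAI (n : ℕ) (m : {p : Fin n × Fin n // p.1 ≤ p.2} → ℕ) : OqMat n :=
  ((pairListAI n).map fun p => xAI p.1 p.2 ^ (if h : p.1 ≤ p.2 then m ⟨p, h⟩ else 0)).prod

/-- the ordered monomial with the factors in the reversed order -/
def monoAIrev (n : ℕ) (m : {p : Fin n × Fin n // p.1 ≤ p.2} → ℕ) : OqMat n :=
  ((pairListAI n).reverse.map fun p => xAI p.1 p.2 ^ (if h : p.1 ≤ p.2 then m ⟨p, h⟩ else 0)).prod

section Legs

variable {A : Type*} [Ring A] {n : ℕ}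

/-- `M ⊗ 1` -/
def legOne (M : Matrix (Fin n) (Fin n) A) : Matrix (Fin n × Fin n) (Fin n × Fin n) A :=
  fun x y => if x.2 = y.2 then M x.1 y.1 else 0

/-- `1 ⊗ M` -/
def legTwo (M : Matrix (Fin n) (Fin n) A) : Matrix (Fin n × Fin n) (Fin n × Fin n) A :=
  fun x y => if x.1 = y.1 then M x.2 y.2 else 0

theorem legOne_mul (M N : Matrix (Fin n) (Fin n) A) :
    legOne (M * N) = legOne M * legOne N := by
  ext ⟨i, k⟩ ⟨j, l⟩
  simp only [legOne, Matrix.mul_apply, Fintype.sum_prod_type, ite_mul, mul_ite, zero_mul, mul_zero]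
  split_ifs <;> simp_all

theorem legTwo_mul (M N : Matrix (Fin n) (Fin n) A) :
    legTwo (M * N) = legTwo M * legTwo N := by
  ext ⟨i, k⟩ ⟨j, l⟩
  simp only [legTwo, Matrix.mul_apply, Fintype.sum_prod_type_right, ite_mul, mul_ite, zero_mul,
    mul_zero]
  split_ifs <;> simp_all

theorem legOne_mul_legTwo (M N : Matrix (Fin n) (Fin n) A) (i j k l : Fin n) :
    (legOne M * legTwo N) (i, k) (j, l) = M i j * N k l := by
  simp [legOne, legTwo, Matrix.mul_apply, Fintype.sum_prod_type]

theorem legTwo_mul_legOne (M N : Matrix (Fin n) (Fin n) A) (i j k l : Fin n) :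
    (legTwo M * legOne N) (i, k) (j, l) = M k l * N i j := by
  simp [legOne, legTwo, Matrix.mul_apply, Fintype.sum_prod_type]

theorem legOne_mul_apply (M : Matrix (Fin n) (Fin n) A)
    (N : Matrix (Fin n × Fin n) (Fin n × Fin n) A) (i k : Fin n) (z) :
    (legOne M * N) (i, k) z = ∑ a, M i a * N (a, k) z := by
  simp [legOne, Matrix.mul_apply, Fintype.sum_prod_type]

theorem legTwo_mul_apply (M : Matrix (Fin n) (Fin n) A)
    (N : Matrix (Fin n × Fin n) (Fin n × Fin n) A) (i k : Fin n) (z) :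
    (legTwo M * N) (i, k) z = ∑ a, M k a * N (i, a) z := by
  simp [legTwo, Matrix.mul_apply, Fintype.sum_prod_type]

end Legs

/-- The commutation relations of a quantum matrix, as the entries of `R T₁ T₂ = T₂ T₁ R`. -/
def IsQMatrix {A : Type*} [Ring A] [Algebra K A] {n : ℕ} (t : Matrix (Fin n) (Fin n) A) : Prop :=
  ∀ i j k l,
    (if i = k then q else 1) • (t i j * t k l) + (if k < i then q - q⁻¹ else 0) • (t k j * t i l) =
    (if j = l then q else 1) • (t k l * t i j) + (if j < l then q - q⁻¹ else 0) • (t k j * t i l)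

theorem smul_smul_eq_add {F M : Type*} [Field F] [AddCommGroup M] [Module F M] {a : F} (ha : a ≠ 0)
    (x : M) : a • a • x = (1 : F) • x + (a - a⁻¹) • a • x := by
  match_scalars
  field_simp
  ring

theorem q_ne_zero : q ≠ 0 := RatFunc.X_ne_zero

section QMatrix

variable {A : Type*} [Ring A] [Algebra K A] {n : ℕ}

theorem IsQMatrix.of_relations {t : Matrix (Fin n) (Fin n) A}
    (hrow : ∀ l i j, i < j → t l i * t l j = q • (t l j * t l i))
    (hcol : ∀ l i j, i < j → t i l * t j l = q • (t j l * t i l))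
    (hanti : ∀ i k j l, i < k → j < l → t i l * t k j = t k j * t i l)
    (hmain : ∀ i k j l, i < k → j < l →
      t i j * t k l = t k l * t i j + (q - q⁻¹) • (t k j * t i l)) :
    IsQMatrix t := by
  have hq := q_ne_zero
  intro i j k l
  rcases lt_trichotomy i k with hik | rfl | hik <;> rcases lt_trichotomy j l with hjl | rfl | hjl
  · simp [hik.ne, hjl.ne, hik.not_gt, hjl, hmain i k j l hik hjl]
  · simp [hik.ne, hik.not_gt, hcol j i k hik]
  · simp [hik.ne, hik.not_gt, hjl.ne', hjl.not_gt, hanti i k l j hik hjl]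
  · simp only [if_true, lt_irrefl, if_false, hjl.ne, hjl, hrow i j l hjl]
    simpa using smul_smul_eq_add hq (t i l * t i j)
  · simp
  · simp [hjl.ne', hjl.not_gt, hrow i l j hjl]
  · simp [hik.ne', hik, hjl.ne, hjl, hanti k i j l hik hjl]
  · simp only [if_true, lt_irrefl, if_false, hik.ne', hik, hcol j k i hik]
    simpa using (smul_smul_eq_add hq (t i j * t k j)).symm
  · simp [hik.ne', hik, hjl.ne', hjl.not_gt, hmain k i l j hik hjl, (hanti k i l j hik hjl)]

theorem IsQMatrix.row {t : Matrix (Fin n) (Fin n) A} (h : IsQMatrix t) (l i j : Fin n)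
    (hij : i < j) : t l i * t l j = q • (t l j * t l i) := by
  have := h l j l i
  simpa [hij.ne', hij.not_gt] using this.symm

theorem IsQMatrix.col {t : Matrix (Fin n) (Fin n) A} (h : IsQMatrix t) (l i j : Fin n)
    (hij : i < j) : t i l * t j l = q • (t j l * t i l) := by
  have := h i l j l
  simpa [hij.ne, hij.not_gt] using this

theorem IsQMatrix.anti {t : Matrix (Fin n) (Fin n) A} (h : IsQMatrix t) (i k j l : Fin n)
    (hik : i < k) (hjl : j < l) : t i l * t k j = t k j * t i l := by
  have := h i l k j
  simpa [hik.ne, hik.not_gt, hjl.ne', hjl.not_gt] using this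

theorem IsQMatrix.main {t : Matrix (Fin n) (Fin n) A} (h : IsQMatrix t) (i k j l : Fin n)
    (hik : i < k) (hjl : j < l) :
    t i j * t k l = t k l * t i j + (q - q⁻¹) • (t k j * t i l) := by
  have := h i j k l
  simpa [hik.ne, hik.not_gt, hjl.ne, hjl] using this

/-- The product of two quantum matrices with mutually commuting entries is a quantum matrix. -/
theorem IsQMatrix.mul {a b : Matrix (Fin n) (Fin n) A} (ha : IsQMatrix a) (hb : IsQMatrix b)
    (hab : ∀ i j k l, Commute (a i j) (b k l)) : IsQMatrix (a * b) := by
  have expand : ∀ i j k l, (a * b) i j * (a * b) k l =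
      ∑ x, ∑ y, (a i x * a k y) * (b x j * b y l) := by
    intro i j k l
    simp only [Matrix.mul_apply, Finset.sum_mul_sum]
    refine Finset.sum_congr rfl fun x _ => Finset.sum_congr rfl fun y _ => ?_
    rw [mul_assoc, ← mul_assoc (b x j), ← (hab k y x j).eq]; simp only [mul_assoc]
  have expand' : ∀ i j k l, (a * b) i j * (a * b) k l =
      ∑ x, ∑ y, (a i y * a k x) * (b y j * b x l) := by
    intro i j k l; rw [expand, Finset.sum_comm]
  intro i j k l
  calc _ = ∑ x, ∑ y, ((if i = k then q else 1) • (a i x * a k y) +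
          (if k < i then q - q⁻¹ else 0) • (a k x * a i y)) * (b x j * b y l) := by
        simp only [expand, Finset.smul_sum, ← Finset.sum_add_distrib, add_mul, smul_mul_assoc]
    _ = ∑ x, ∑ y, ((if x = y then q else 1) • (a k y * a i x) +
          (if x < y then q - q⁻¹ else 0) • (a k x * a i y)) * (b x j * b y l) := by
        simp only [ha i _ k _]
    _ = ∑ x, ∑ y, (a k y * a i x) * ((if x = y then q else 1) • (b x j * b y l) +
          (if y < x then q - q⁻¹ else 0) • (b y j * b x l)) := by
        simp only [add_mul, mul_add, Finset.sum_add_distrib, smul_mul_assoc, mul_smul_comm]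
        congr 1
        rw [Finset.sum_comm]
    _ = ∑ x, ∑ y, (a k y * a i x) * ((if j = l then q else 1) • (b y l * b x j) +
          (if j < l then q - q⁻¹ else 0) • (b y j * b x l)) := by
        simp only [hb _ j _ l]
    _ = _ := by
        rw [expand' k l i j, expand' k j i l]
        simp only [Finset.smul_sum, ← Finset.sum_add_distrib, mul_add, mul_smul_comm]

/-- The standard `R`-matrix of type `A`. -/
def rMat (n : ℕ) (A : Type*) [Ring A] [Algebra K A] :
    Matrix (Fin n × Fin n) (Fin n × Fin n) A := fun x y =>
  (if x = y then algebraMap K A (if x.1 = x.2 then q else 1) else 0) +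
  (if x.swap = y then algebraMap K A (if x.2 < x.1 then q - q⁻¹ else 0) else 0)

/-- The partial transpose of the `R`-matrix in the first tensor factor. -/
def rMatTr (n : ℕ) (A : Type*) [Ring A] [Algebra K A] :
    Matrix (Fin n × Fin n) (Fin n × Fin n) A := fun x y =>
  (if x = y then algebraMap K A (if x.1 = x.2 then q else 1) else 0) +
  (if x.1 = x.2 ∧ y.1 = y.2 then algebraMap K A (if x.1 < y.1 then q - q⁻¹ else 0) else 0)

theorem rMat_mul (M : Matrix (Fin n × Fin n) (Fin n × Fin n) A) (i k : Fin n) (z) :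
    (rMat n A * M) (i, k) z = (if i = k then q else 1) • M (i, k) z +
      (if k < i then q - q⁻¹ else 0) • M (k, i) z := by
  simp only [rMat, Matrix.mul_apply, add_mul, Finset.sum_add_distrib, ite_mul, zero_mul,
    Finset.sum_ite_eq, Finset.mem_univ, if_true, ← Algebra.smul_def, Prod.swap_prod_mk]

theorem mul_rMat (M : Matrix (Fin n × Fin n) (Fin n × Fin n) A) (j l : Fin n) (z) :
    (M * rMat n A) z (j, l) = (if j = l then q else 1) • M z (j, l) +
      (if j < l then q - q⁻¹ else 0) • M z (l, j) := by
  have h : ∀ x : Fin n × Fin n, x.swap = (j, l) ↔ x = (l, j) := fun x => by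
    rw [← Prod.swap_inj]; simp
  simp only [rMat, Matrix.mul_apply, mul_add, Finset.sum_add_distrib, mul_ite, mul_zero, h,
    Finset.sum_ite_eq', Finset.mem_univ, if_true]
  simp only [← Algebra.commutes, ← Algebra.smul_def]

theorem rMatTr_mul (M : Matrix (Fin n × Fin n) (Fin n × Fin n) A) (i k : Fin n) (z) :
    (rMatTr n A * M) (i, k) z = (if i = k then q else 1) • M (i, k) z +
      ∑ a, if i = k ∧ i < a then (q - q⁻¹) • M (a, a) z else 0 := by
  simp only [rMatTr, Matrix.mul_apply, add_mul, Finset.sum_add_distrib, ite_mul, zero_mul,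
    Finset.sum_ite_eq, Finset.mem_univ, if_true, ← Algebra.smul_def]
  congr 1
  rw [Fintype.sum_prod_type]
  refine Finset.sum_congr rfl fun a _ => ?_
  rw [Finset.sum_eq_single a]
  · by_cases h1 : i = k <;> by_cases h2 : i < a <;> simp [h1, h2]
  · intro b _ hb; simp [hb.symm]
  · simp

theorem rMat_mul_rMatTr : rMat n A * rMatTr n A = rMatTr n A * rMat n A := by
  ext ⟨i, k⟩ ⟨j, l⟩
  rw [rMat_mul, mul_rMat]
  simp only [rMatTr, Prod.mk.injEq]
  by_cases h1 : i = k <;> by_cases h2 : j = l <;> by_cases h3 : i = j <;> by_cases h4 : k = l <;>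
    by_cases h5 : i = l <;> by_cases h6 : k = j <;> simp_all

theorem IsQMatrix.rMat_mul_legs {t : Matrix (Fin n) (Fin n) A} (h : IsQMatrix t) :
    rMat n A * (legOne t * legTwo t) = legTwo t * legOne t * rMat n A := by
  ext ⟨i, k⟩ ⟨j, l⟩
  simp only [rMat_mul, mul_rMat, legOne_mul_legTwo, legTwo_mul_legOne, h i j k l]

theorem IsQMatrix.legs_tr_mul_rMat {t : Matrix (Fin n) (Fin n) A} (h : IsQMatrix t) :
    legTwo t.transpose * legOne t.transpose * rMat n A =
      rMat n A * (legOne t.transpose * legTwo t.transpose) := by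
  ext ⟨i, k⟩ ⟨j, l⟩
  simp only [rMat_mul, mul_rMat, legOne_mul_legTwo, legTwo_mul_legOne, Matrix.transpose_apply]
  have := h l k j i
  simpa [eq_comm] using this

theorem rMatTr_mul_legTwo (M : Matrix (Fin n) (Fin n) A) (i j k l : Fin n) :
    (rMatTr n A * legTwo M) (i, k) (j, l) =
      (if i = j then (if i = k then q else 1) • M k l else 0) +
      (if i = k then if i < j then (q - q⁻¹) • M j l else 0 else 0) := by
  rw [rMatTr_mul, Finset.sum_eq_single j]
  · simp [legTwo, ite_and]
  · intro a _ ha; simp [legTwo, ha]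
  · simp

theorem rMatTr_mul_legOne (M : Matrix (Fin n) (Fin n) A) (i j k l : Fin n) :
    (rMatTr n A * legOne M) (i, k) (j, l) =
      (if k = l then (if i = k then q else 1) • M i j else 0) +
      (if i = k then if i < l then (q - q⁻¹) • M l j else 0 else 0) := by
  rw [rMatTr_mul, Finset.sum_eq_single l]
  · simp [legOne, ite_and]
  · intro a _ ha; simp [legOne, ha]
  · simp

theorem IsQMatrix.legOne_tr {t : Matrix (Fin n) (Fin n) A} (h : IsQMatrix t) :
    legOne t.transpose * (rMatTr n A * legTwo t) = legTwo t * (rMatTr n A * legOne t.transpose) := by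
  ext ⟨j, k⟩ ⟨i, l⟩
  have := h i j k l
  simpa [legOne_mul_apply, legTwo_mul_apply, rMatTr_mul_legOne, rMatTr_mul_legTwo, mul_add,
    Finset.sum_add_distrib, @eq_comm _ j l] using this

theorem IsQMatrix.legTwo_tr {t : Matrix (Fin n) (Fin n) A} (h : IsQMatrix t) :
    legTwo t.transpose * (rMatTr n A * legOne t) = legOne t * (rMatTr n A * legTwo t.transpose) := by
  ext ⟨j, k⟩ ⟨i, l⟩
  have := h l k j i
  simpa [legOne_mul_apply, legTwo_mul_apply, rMatTr_mul_legOne, rMatTr_mul_legTwo, mul_add,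
    Finset.sum_add_distrib, @eq_comm _ j l, @eq_comm _ i k] using this

theorem IsQMatrix.reflection {t : Matrix (Fin n) (Fin n) A} (h : IsQMatrix t) :
    rMat n A * legOne (t * t.transpose) * (rMatTr n A * legTwo (t * t.transpose)) =
      legTwo (t * t.transpose) * rMatTr n A * (legOne (t * t.transpose) * rMat n A) := by
  have h1 := h.rMat_mul_legs
  have h2 := h.legs_tr_mul_rMat
  have h3 := h.legOne_tr
  have h4 := h.legTwo_tr
  have h5 := rMat_mul_rMatTr (n := n) (A := A)
  rw [legOne_mul, legTwo_mul]
  set R := rMat n A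
  set S := rMatTr n A
  set T := legOne t
  set U := legTwo t
  set T' := legOne t.transpose
  set U' := legTwo t.transpose
  calc R * (T * T') * (S * (U * U')) = R * T * (T' * (S * U)) * U' := by noncomm_ring
    _ = (R * (T * U)) * S * T' * U' := by rw [h3]; noncomm_ring
    _ = U * T * (R * S) * T' * U' := by rw [h1]; noncomm_ring
    _ = U * T * S * (R * (T' * U')) := by rw [h5]; noncomm_ring
    _ = U * (T * (S * U')) * T' * R := by rw [← h2]; noncomm_ring
    _ = _ := by rw [← h4]; noncomm_ring

theorem IsQMatrix.reflection_apply {t X : Matrix (Fin n) (Fin n) A} (h : IsQMatrix t)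
    (hX : X = t * t.transpose) (i j k l : Fin n) :
    (if i = k then q else 1) • ((if j = k then q else 1) • (X i j * X k l) +
        (if k < j then q - q⁻¹ else 0) • (X i k * X j l)) +
      (if k < i then q - q⁻¹ else 0) • ((if j = i then q else 1) • (X k j * X i l) +
        (if i < j then q - q⁻¹ else 0) • (X k i * X j l)) =
    (if j = l then q else 1) • ((if i = l then q else 1) • (X k l * X i j) +
        (if i < l then q - q⁻¹ else 0) • (X k i * X l j)) +
      (if j < l then q - q⁻¹ else 0) • ((if i = j then q else 1) • (X k j * X i l) +
        (if i < j then q - q⁻¹ else 0) • (X k i * X j l)) := by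
  have := congrFun (congrFun h.reflection (i, k)) (j, l)
  rw [← hX, mul_assoc (rMat n A), rMat_mul, ← mul_assoc (legTwo X * _) _ (rMat n A), mul_rMat] at this
  simpa [mul_assoc, legOne_mul_apply, legTwo_mul_apply, rMatTr_mul_legOne, rMatTr_mul_legTwo,
    mul_add, Finset.sum_add_distrib] using this

end QMatrix

/-- Straightening of a product of two generators in the wrong order: the correction terms have
their first factor strictly between the two generators. -/
theorem reflection_straighten {F A ι : Type*} [Field F] [Ring A] [Algebra F A] [LinearOrder ι]
    {p : F} (hp : p ≠ 0) {X : ι → ι → A} (hX : ∀ i j, i < j → X j i = p⁻¹ • X i j)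
    (hR : ∀ i j k l,
      (if i = k then p else 1) • ((if j = k then p else 1) • (X i j * X k l) +
          (if k < j then p - p⁻¹ else 0) • (X i k * X j l)) +
        (if k < i then p - p⁻¹ else 0) • ((if j = i then p else 1) • (X k j * X i l) +
          (if i < j then p - p⁻¹ else 0) • (X k i * X j l)) =
      (if j = l then p else 1) • ((if i = l then p else 1) • (X k l * X i j) +
          (if i < l then p - p⁻¹ else 0) • (X k i * X l j)) +
        (if j < l then p - p⁻¹ else 0) • ((if i = j then p else 1) • (X k j * X i l) +
          (if i < j then p - p⁻¹ else 0) • (X k i * X j l)))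
    {i j k l : ι} (hij : i ≤ j) (hkl : k ≤ l) (hlt : k < i ∨ k = i ∧ l < j) :
    ∃ c α β : F, c ≠ 0 ∧
      X i j * X k l = c • (X k l * X i j) + α • (X k i * X j l) + β • (X k j * X i l) ∧
      (α ≠ 0 → k < i ∧ l < i) ∧ (β ≠ 0 → k < i ∧ l < j) := by
  have h := hR i j k l
  rcases hlt with hki | ⟨rfl, hlj⟩
  · have hkj := hki.trans_le hij
    have hik := hX _ _ hki
    rcases hij.lt_or_eq with hij' | rfl
    · rcases lt_trichotomy l i with hli | rfl | hli
      · have hlj := hli.trans hij'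
        refine ⟨1, -((p - p⁻¹) * p), -(p - p⁻¹), one_ne_zero, ?_, fun _ => ⟨hki, hli⟩,
          fun _ => ⟨hki, hlj⟩⟩
        simp only [hki, hki.ne', hij', hij'.ne, hij'.ne', hkj, hkj.ne', hli.not_gt, hli.ne',
          hlj.not_gt, hlj.ne', hik, if_true, if_false, smul_mul_assoc] at h
        linear_combination (norm := (match_scalars <;> field_simp <;> ring)) h
      · refine ⟨p⁻¹, 0, -(p - p⁻¹), inv_ne_zero hp, ?_, fun h => absurd rfl h, fun _ => ⟨hki, hij'⟩⟩
        have hji := hX _ _ hij'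
        simp only [hki, hki.ne', hij', hij'.ne', hkj, hkj.ne', hij'.not_gt,
          lt_irrefl, hik, hji, if_true, if_false, smul_mul_assoc, mul_smul_comm] at h
        simp only [hji, mul_smul_comm]
        linear_combination (norm := (match_scalars <;> field_simp <;> ring)) h
      · rcases lt_trichotomy l j with hlj | rfl | hlj
        · refine ⟨1, 0, -(p - p⁻¹), one_ne_zero, ?_, fun h => absurd rfl h, fun _ => ⟨hki, hlj⟩⟩
          have hjl := hX _ _ hlj
          simp only [hki, hki.ne', hij', hij'.ne', hkj, hkj.ne', hli, hli.ne,
            hlj.not_gt, hlj.ne', hik, hjl, if_true, if_false, smul_mul_assoc, mul_smul_comm] at h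
          simp only [hjl, mul_smul_comm]
          linear_combination (norm := (match_scalars <;> field_simp <;> ring)) h
        · refine ⟨p⁻¹, 0, 0, inv_ne_zero hp, ?_, fun h => absurd rfl h, fun h => absurd rfl h⟩
          simp only [hki, hki.ne', hij', hij'.ne, hij'.ne', hkj, hkj.ne',
            lt_irrefl, hik, if_true, if_false, smul_mul_assoc] at h
          linear_combination (norm := (match_scalars <;> field_simp <;> ring)) h
        · refine ⟨1, 0, 0, one_ne_zero, ?_, fun h => absurd rfl h, fun h => absurd rfl h⟩
          have hjl := hX _ _ hlj
          simp only [hki, hki.ne', hij', hij'.ne, hij'.ne', hkj, hkj.ne', hli, hli.ne,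
            hlj, hlj.ne, hik, hjl, if_true, if_false, smul_mul_assoc, mul_smul_comm] at h
          linear_combination (norm := (match_scalars <;> field_simp <;> ring)) h
    · rcases lt_trichotomy l i with hli | rfl | hli
      · refine ⟨1, -((p - p⁻¹) * p⁻¹), -(p - p⁻¹) * p, one_ne_zero, ?_, fun _ => ⟨hki, hli⟩,
          fun _ => ⟨hki, hli⟩⟩
        simp only [hki, hki.ne', lt_irrefl, hli.not_gt, hli.ne', hik, if_true, if_false,
          smul_mul_assoc] at h
        linear_combination (norm := (match_scalars <;> field_simp <;> ring)) h
      · refine ⟨p⁻¹ * p⁻¹, 0, 0, mul_ne_zero (inv_ne_zero hp) (inv_ne_zero hp), ?_,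
          fun h => absurd rfl h, fun h => absurd rfl h⟩
        simp only [hki, hki.ne', lt_irrefl, hik, if_true, if_false,
          smul_mul_assoc] at h
        linear_combination (norm := (match_scalars <;> field_simp <;> ring)) h
      · refine ⟨1, 0, 0, one_ne_zero, ?_, fun h => absurd rfl h, fun h => absurd rfl h⟩
        have hil := hX _ _ hli
        simp only [hki, hki.ne', lt_irrefl, hli, hli.ne, hik, hil, if_true, if_false,
          smul_mul_assoc, mul_smul_comm] at h
        linear_combination (norm := (match_scalars <;> field_simp <;> ring)) h
  · have hjl := hX _ _ hlj
    have hkj := hkl.trans_lt hlj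
    rcases hkl.lt_or_eq with hkl' | rfl
    · refine ⟨p⁻¹, 0, 0, inv_ne_zero hp, ?_, fun h => absurd rfl h, fun h => absurd rfl h⟩
      simp only [lt_irrefl, hkl', hkl'.ne, hlj.ne', hlj.not_gt, hkj, hkj.ne', hjl, if_true,
        if_false, mul_smul_comm] at h
      linear_combination (norm := (match_scalars <;> field_simp <;> ring)) p⁻¹ • h
    · refine ⟨p⁻¹ * p⁻¹, 0, 0, mul_ne_zero (inv_ne_zero hp) (inv_ne_zero hp), ?_,
        fun h => absurd rfl h, fun h => absurd rfl h⟩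
      simp only [lt_irrefl, hlj, hlj.ne', hlj.not_gt, hjl, if_true,
        if_false, mul_smul_comm] at h
      linear_combination (norm := (match_scalars <;> field_simp <;> ring)) p⁻¹ • h

section Straightening

variable {F A ι L : Type*} [CommSemiring F] [Semiring A] [Algebra F A] [LinearOrder L]

/-- The span of the products of `d` generators, weakly increasing with respect to `ρ`. -/
def sortedSpan (F : Type*) {A ι L : Type*} [CommSemiring F] [Semiring A] [Algebra F A]
    [LinearOrder L] (ρ : ι → L) (g : ι → A) (d : ℕ) : Submodule F A :=
  Submodule.span F {y | ∃ l : List ι, l.Pairwise (fun a b => ρ a ≤ ρ b) ∧ l.length = d ∧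
    (l.map g).prod = y}

theorem gen_mul_mem_sortedSpan [WellFoundedLT L] {ρ : ι → L} {g : ι → A}
    (hg : ∀ r p, ρ r < ρ p → g p * g r ∈ Submodule.span F {y | ∃ a b, ρ a < ρ p ∧ g a * g b = y})
    (d : ℕ) (p : ι) {w : A} (hw : w ∈ sortedSpan F ρ g d) : g p * w ∈ sortedSpan F ρ g (d + 1) := by
  induction d generalizing p w with
  | zero =>
    refine Submodule.span_induction (p := fun w _ => g p * w ∈ sortedSpan F ρ g (0 + 1))
      ?_ (by simp) (fun x y _ _ hx hy => by rw [mul_add]; exact add_mem hx hy)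
      (fun c x _ hx => by rw [mul_smul_comm]; exact Submodule.smul_mem _ _ hx) hw
    rintro _ ⟨l, -, hl, rfl⟩
    obtain rfl := List.length_eq_zero_iff.mp hl
    exact Submodule.subset_span ⟨[p], by simp, by simp, by simp⟩
  | succ d ih =>
    induction hp : ρ p using WellFoundedLT.induction generalizing p w with
    | ind x ihp =>
    subst hp
    refine Submodule.span_induction (p := fun w _ => g p * w ∈ sortedSpan F ρ g (d + 1 + 1))
      ?_ (by simp) (fun x y _ _ hx hy => by rw [mul_add]; exact add_mem hx hy)
      (fun c x _ hx => by rw [mul_smul_comm]; exact Submodule.smul_mem _ _ hx) hw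
    rintro _ ⟨l, hs, hl, rfl⟩
    match l, hs, hl with
    | r :: l, hs, hl =>
      rw [List.pairwise_cons] at hs
      rcases le_or_gt (ρ p) (ρ r) with hpr | hpr
      · refine Submodule.subset_span ⟨p :: r :: l, ?_, by simpa using hl, by simp⟩
        simp only [List.pairwise_cons, List.mem_cons, forall_eq_or_imp]
        exact ⟨⟨hpr, fun a ha => hpr.trans (hs.1 a ha)⟩, hs⟩
      · have hl' : (l.map g).prod ∈ sortedSpan F ρ g d :=
          Submodule.subset_span ⟨l, hs.2, by simpa using hl, rfl⟩
        rw [List.map_cons, List.prod_cons, ← mul_assoc]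
        refine Submodule.span_induction
          (p := fun y _ => y * (l.map g).prod ∈ sortedSpan F ρ g (d + 1 + 1))
          ?_ (by simp) (fun x y _ _ hx hy => by rw [add_mul]; exact add_mem hx hy)
          (fun c x _ hx => by rw [smul_mul_assoc]; exact Submodule.smul_mem _ _ hx) (hg r p hpr)
        rintro _ ⟨a, b, ha, rfl⟩
        rw [mul_assoc]
        exact ihp _ ha a (ih b hl') rfl

theorem prod_pow_count [DecidableEq ι] {ρ : ι → L} (hρ : Function.Injective ρ) (g : ι → A)
    {E : List ι} (hE : E.Pairwise fun a b => ρ a < ρ b) (hmem : ∀ a, a ∈ E)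
    {l : List ι} (hl : l.Pairwise fun a b => ρ a ≤ ρ b) :
    (E.map fun p => g p ^ l.count p).prod = (l.map g).prod := by
  have hnd : E.Nodup := hE.imp fun h e => by simp [e] at h
  have key : l = E.flatMap fun p => List.replicate (l.count p) p := by
    refine List.Perm.eq_of_pairwise (le := fun a b => ρ a ≤ ρ b)
      (fun a b _ _ h1 h2 => hρ (le_antisymm h1 h2)) hl ?_ ?_
    · rw [List.pairwise_flatMap]
      refine ⟨fun a _ => by simp [List.pairwise_replicate], hE.imp fun h => ?_⟩
      intro x hx y hy
      rw [List.eq_of_mem_replicate hx, List.eq_of_mem_replicate hy]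
      exact h.le
    · rw [List.perm_iff_count]
      intro a
      rw [List.count_flatMap]
      have : (List.count a ∘ fun p => List.replicate (l.count p) p) =
          fun p => if p = a then l.count a else 0 := by
        ext p
        by_cases h : p = a
        · simp [h]
        · simp [List.count_replicate, h]
      rw [this, ← List.sum_toFinset _ hnd]
      simp [hmem a]
  conv_rhs => rw [key]
  rw [List.map_flatMap, List.flatMap, List.prod_flatten, List.map_map]
  congr 1
  refine List.map_congr_left fun p _ => ?_
  simp

theorem span_monomials_eq_adjoin [WellFoundedLT L] {ρ : ι → L} (hρ : Function.Injective ρ)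
    {g : ι → A}
    (hg : ∀ r p, ρ r < ρ p → g p * g r ∈ Submodule.span F {y | ∃ a b, ρ a < ρ p ∧ g a * g b = y})
    {E : List ι} (hE : E.Pairwise fun a b => ρ a < ρ b) (hmem : ∀ a, a ∈ E) :
    Submodule.span F (Set.range fun m : ι → ℕ => (E.map fun p => g p ^ m p).prod) =
      Subalgebra.toSubmodule (Algebra.adjoin F (Set.range g)) := by
  classical
  apply le_antisymm
  · rw [Submodule.span_le]
    rintro _ ⟨m, rfl⟩
    refine Subalgebra.list_prod_mem _ fun y hy => ?_
    obtain ⟨p, -, rfl⟩ := List.mem_map.mp hy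
    exact pow_mem (Algebra.subset_adjoin (Set.mem_range_self p)) _
  · rw [Algebra.adjoin_eq_span, Submodule.span_le]
    intro y hy
    suffices ∃ d, y ∈ sortedSpan F ρ g d by
      obtain ⟨d, hd⟩ := this
      refine (Submodule.span_le.mpr ?_ : sortedSpan F ρ g d ≤ _) hd
      rintro _ ⟨l, hl, -, rfl⟩
      exact Submodule.subset_span ⟨fun p => l.count p, prod_pow_count hρ g hE hmem hl⟩
    induction hy using Submonoid.closure_induction_left with
    | one => exact ⟨0, Submodule.subset_span ⟨[], by simp, rfl, by simp⟩⟩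
    | mul_left x hx y _ ih =>
      obtain ⟨p, rfl⟩ := hx
      obtain ⟨d, hd⟩ := ih
      exact ⟨d + 1, gen_mul_mem_sortedSpan hg d p hd⟩

end Straightening

section Representation

/-- The polynomial representation space: exponent `v (a, b)` belongs to the variable of the `a`-th
bidiagonal factor in row `b`. -/
abbrev PolySpace : Type := (ℕ × ℕ →₀ ℕ) →₀ K

/-- The operator `e_v ↦ f(v) e_{v + γ}`. -/
def monoOp (γ : ℕ × ℕ →₀ ℕ) (f : (ℕ × ℕ →₀ ℕ) → K) : Module.End K PolySpace :=
  Finsupp.linearCombination K fun v => Finsupp.single (v + γ) (f v)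

theorem monoOp_single (γ : ℕ × ℕ →₀ ℕ) (f : (ℕ × ℕ →₀ ℕ) → K) (v : ℕ × ℕ →₀ ℕ) (c : K) :
    monoOp γ f (Finsupp.single v c) = Finsupp.single (v + γ) (c * f v) := by
  simp [monoOp]

theorem monoOp_mul (γ δ : ℕ × ℕ →₀ ℕ) (f g : (ℕ × ℕ →₀ ℕ) → K) :
    monoOp γ f * monoOp δ g = monoOp (γ + δ) fun v => g v * f (v + δ) := by
  refine Finsupp.lhom_ext fun v c => ?_
  rw [Module.End.mul_apply, monoOp_single, monoOp_single, monoOp_single, mul_assoc, add_assoc,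
    add_comm δ γ]

theorem smul_monoOp (c : K) (γ : ℕ × ℕ →₀ ℕ) (f : (ℕ × ℕ →₀ ℕ) → K) :
    c • monoOp γ f = monoOp γ fun v => c * f v := by
  refine Finsupp.lhom_ext fun v a => ?_
  rw [LinearMap.smul_apply, monoOp_single, monoOp_single, Finsupp.smul_single, smul_eq_mul,
    mul_left_comm]

theorem monoOp_commute {γ δ : ℕ × ℕ →₀ ℕ} {f g : (ℕ × ℕ →₀ ℕ) → K}
    (hf : ∀ v, f (v + δ) = f v) (hg : ∀ v, g (v + γ) = g v) :
    Commute (monoOp γ f) (monoOp δ g) := by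
  rw [Commute, SemiconjBy, monoOp_mul, monoOp_mul, add_comm γ δ]
  simp only [hf, hg, mul_comm]

/-- The diagonal scaling by independent variables. -/
def scaling (n : ℕ) : Matrix (Fin n) (Fin n) (Module.End K PolySpace) := fun i j =>
  if i = j then monoOp (Finsupp.single (0, i.val) 1) fun _ => 1 else 0

/-- The diagonal entries of the `a`-th bidiagonal factor. -/
def diagOp (a i : ℕ) : Module.End K PolySpace :=
  monoOp 0 fun v => q ^ ((v (a, i + 1) : ℤ) - v (a, i))

/-- The subdiagonal entries of the `a`-th bidiagonal factor. -/
def subOp (a i : ℕ) : Module.End K PolySpace :=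
  monoOp (Finsupp.single (a, i) 1) fun _ => 1

/-- The `a`-th lower bidiagonal quantum matrix. -/
def bidiagonal (n a : ℕ) : Matrix (Fin n) (Fin n) (Module.End K PolySpace) := fun i j =>
  if i = j then diagOp a i else if i.val = j.val + 1 then subOp a i else 0

/-- The product of the scaling and the first `N` bidiagonal quantum matrices. -/
def triangular (n : ℕ) : ℕ → Matrix (Fin n) (Fin n) (Module.End K PolySpace)
  | 0 => scaling n
  | N + 1 => triangular n N * bidiagonal n (N + 1)

theorem diagOp_commute (a b i j : ℕ) : Commute (diagOp a i) (diagOp b j) :=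
  monoOp_commute (by simp) (by simp)

theorem subOp_commute (a b i j : ℕ) : Commute (subOp a i) (subOp b j) :=
  monoOp_commute (by simp) (by simp)

theorem diagOp_commute_subOp {a b i j : ℕ} (h : a ≠ b ∨ (i ≠ j ∧ i + 1 ≠ j)) :
    Commute (diagOp a i) (subOp b j) := by
  refine monoOp_commute (fun v => ?_) (by simp)
  have h1 : (b, j) ≠ (a, i + 1) := by grind
  have h2 : (b, j) ≠ (a, i) := by grind
  simp [Finsupp.single_eq_of_ne' h1, Finsupp.single_eq_of_ne' h2]

theorem diagOp_mul_subOp (a i : ℕ) :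
    diagOp a i * subOp a (i + 1) = q • (subOp a (i + 1) * diagOp a i) := by
  have h : (a, i + 1) ≠ (a, i) := by simp
  simp only [diagOp, subOp, monoOp_mul, smul_monoOp, add_comm (0 : ℕ × ℕ →₀ ℕ)]
  congr 1
  ext1 v
  simp only [Finsupp.add_apply, Finsupp.single_eq_same, Finsupp.single_eq_of_ne' h, add_zero,
    one_mul, mul_one, Nat.cast_add, Nat.cast_one]
  rw [← zpow_one_add₀ q_ne_zero]
  congr 1
  ring

theorem subOp_mul_diagOp (a i : ℕ) : subOp a i * diagOp a i = q • (diagOp a i * subOp a i) := by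
  have h : (a, i) ≠ (a, i + 1) := by simp
  simp only [diagOp, subOp, monoOp_mul, smul_monoOp, add_comm (0 : ℕ × ℕ →₀ ℕ)]
  congr 1
  ext1 v
  simp only [Finsupp.add_apply, Finsupp.single_eq_same, Finsupp.single_eq_of_ne' h, add_zero,
    one_mul, mul_one, Nat.cast_add, Nat.cast_one]
  rw [← zpow_one_add₀ q_ne_zero]
  congr 1
  ring

theorem isQMatrix_scaling (n : ℕ) : IsQMatrix (scaling n) := by
  have hc : ∀ i j, Commute (monoOp (Finsupp.single (0, i) 1) fun _ => 1)
    (monoOp (Finsupp.single (0, j) 1) fun _ => 1) := fun i j => monoOp_commute (by simp) (by simp)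
  refine .of_relations ?_ ?_ ?_ ?_
  · intro l i j h; unfold scaling; split_ifs <;> simp_all
  · intro l i j h; unfold scaling; split_ifs <;> simp_all
  · intro i k j l h1 h2; unfold scaling; split_ifs <;> simp_all [(hc _ _).eq]
  · intro i k j l h1 h2; unfold scaling; split_ifs <;> simp_all [(hc _ _).eq] ; grind

theorem isQMatrix_bidiagonal (n a : ℕ) : IsQMatrix (bidiagonal n a) := by
  refine .of_relations ?_ ?_ ?_ ?_
  · intro l i j h
    unfold bidiagonal
    rw [Fin.lt_def] at h
    simp only [Fin.ext_iff]
    split_ifs <;> first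
      | omega
      | simp only [mul_zero, zero_mul, smul_zero]
      | rw [subOp_mul_diagOp a l]
  · intro l i j h
    unfold bidiagonal
    rw [Fin.lt_def] at h
    simp only [Fin.ext_iff]
    split_ifs with h1 h2 h3 h4 h5 h6 <;> first
      | omega
      | simp only [mul_zero, zero_mul, smul_zero]
      | rw [h3, h1, diagOp_mul_subOp a l]
  · intro i k j l h1 h2
    unfold bidiagonal
    rw [Fin.lt_def] at h1 h2
    simp only [Fin.ext_iff]
    split_ifs <;> first | omega | simp only [mul_zero, zero_mul]
  · intro i k j l h1 h2
    have hdd : Commute (diagOp a i) (diagOp a k) := diagOp_commute _ _ _ _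
    have hss : Commute (subOp a i) (subOp a k) := subOp_commute _ _ _ _
    have hprod : bidiagonal n a k j * bidiagonal n a i l = 0 := by
      unfold bidiagonal
      rw [Fin.lt_def] at h1 h2
      simp only [Fin.ext_iff]
      split_ifs <;> first | omega | simp only [mul_zero, zero_mul]
    rw [hprod, smul_zero, add_zero]
    unfold bidiagonal
    rw [Fin.lt_def] at h1 h2
    simp only [Fin.ext_iff]
    split_ifs <;> first
      | simp only [mul_zero, zero_mul]
      | rw [hdd.eq]
      | rw [hss.eq]
      | rw [(diagOp_commute_subOp (a := a) (b := a) (i := i) (j := k) (Or.inr (by omega))).eq]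
      | rw [(diagOp_commute_subOp (a := a) (b := a) (i := k) (j := i) (Or.inr (by omega))).eq]

theorem triangular_commute_bidiagonal (n : ℕ) {N b : ℕ} (hb : N < b) (i j k l : Fin n) :
    Commute (triangular n N i j) (bidiagonal n b k l) := by
  induction N generalizing i j with
  | zero =>
    simp only [triangular, scaling, bidiagonal]
    have h1 : Commute (monoOp (Finsupp.single (0, i.val) 1) fun _ => 1) (diagOp b k) :=
      (diagOp_commute_subOp (Or.inl hb.ne')).symm
    have h2 : Commute (monoOp (Finsupp.single (0, i.val) 1) fun _ => 1) (subOp b k) :=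
      subOp_commute _ _ _ _
    split_ifs <;> simp_all
  | succ N ih =>
    rw [triangular, Matrix.mul_apply]
    refine Commute.sum_left _ _ _ fun x _ => (ih (by omega) i x).mul_left ?_
    have h1 : Commute (diagOp (N + 1) x) (subOp b k) := diagOp_commute_subOp (Or.inl hb.ne)
    have h2 : Commute (subOp (N + 1) x) (diagOp b k) :=
      (diagOp_commute_subOp (Or.inl hb.ne')).symm
    have h3 : Commute (diagOp (N + 1) x) (diagOp b k) := diagOp_commute _ _ _ _
    have h4 : Commute (subOp (N + 1) x) (subOp b k) := subOp_commute _ _ _ _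
    simp only [bidiagonal]
    split_ifs <;> first
      | assumption
      | exact Commute.zero_right _
      | exact Commute.zero_left _

theorem isQMatrix_triangular (n N : ℕ) : IsQMatrix (triangular n N) := by
  induction N with
  | zero => exact isQMatrix_scaling n
  | succ N ih =>
    exact ih.mul (isQMatrix_bidiagonal n (N + 1)) (triangular_commute_bidiagonal n N.lt_succ_self)

/-- The grading of exponents in which the variables of the `a`-th bidiagonal factor have
weight `a`. -/
abbrev expWeight : (ℕ × ℕ →₀ ℕ) →+ ℕ := Finsupp.weight Prod.fst

/-- The polynomials all of whose exponents have weight at least `d`. -/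
def weightFilt (d : ℕ) : Submodule K PolySpace := Finsupp.supported K K {u | d ≤ expWeight u}

/-- The operator raises weights by at least `d`. -/
def RaisesBy (X : Module.End K PolySpace) (d : ℕ) : Prop :=
  ∀ v, X (Finsupp.single v 1) ∈ weightFilt (expWeight v + d)

/-- Up to terms of higher weight, the operator is multiplication by the monomial with exponent `γ`,
up to a nonzero scalar on every monomial. -/
def HasLead (X : Module.End K PolySpace) (γ : ℕ × ℕ →₀ ℕ) : Prop :=
  ∀ v, ∃ c : K, c ≠ 0 ∧
    X (Finsupp.single v 1) - Finsupp.single (v + γ) c ∈ weightFilt (expWeight v + expWeight γ + 1)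

theorem weightFilt_anti {d e : ℕ} (h : d ≤ e) : weightFilt e ≤ weightFilt d :=
  Finsupp.supported_mono fun _ hu => h.trans hu

theorem single_mem_weightFilt {d : ℕ} {u : ℕ × ℕ →₀ ℕ} (h : d ≤ expWeight u) (c : K) :
    Finsupp.single u c ∈ weightFilt d :=
  Finsupp.single_mem_supported K c h

theorem apply_eq_zero_of_mem_weightFilt {d : ℕ} {f : PolySpace} (hf : f ∈ weightFilt d)
    {u : ℕ × ℕ →₀ ℕ} (hu : expWeight u < d) : f u = 0 := by
  by_contra h
  exact hu.not_ge (hf (Finsupp.mem_support_iff.mpr h))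

theorem RaisesBy.map_mem {X : Module.End K PolySpace} {d e : ℕ} (hX : RaisesBy X d)
    {f : PolySpace} (hf : f ∈ weightFilt e) : X f ∈ weightFilt (e + d) := by
  rw [weightFilt, Finsupp.supported_eq_span_single] at hf
  refine (Submodule.span_le.mpr ?_ : _ ≤ (weightFilt (e + d)).comap X) hf
  rintro _ ⟨u, hu, rfl⟩
  exact weightFilt_anti (Nat.add_le_add_right hu d) (hX u)

theorem RaisesBy.mono {X : Module.End K PolySpace} {d e : ℕ} (hX : RaisesBy X d) (h : e ≤ d) :
    RaisesBy X e := fun v => weightFilt_anti (Nat.add_le_add_left h _) (hX v)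

theorem RaisesBy.zero (d : ℕ) : RaisesBy 0 d := fun _ => by simp

theorem RaisesBy.mul {X Y : Module.End K PolySpace} {d e : ℕ} (hX : RaisesBy X d)
    (hY : RaisesBy Y e) : RaisesBy (X * Y) (d + e) := fun v => by
  have := hX.map_mem (hY v)
  rwa [add_assoc, add_comm e d] at this

theorem RaisesBy.sum {ι : Type*} {s : Finset ι} {f : ι → Module.End K PolySpace} {d : ℕ}
    (h : ∀ i ∈ s, RaisesBy (f i) d) : RaisesBy (∑ i ∈ s, f i) d := fun v => by
  rw [LinearMap.sum_apply]
  exact Submodule.sum_mem _ fun i hi => h i hi v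

theorem HasLead.raisesBy {X : Module.End K PolySpace} {γ : ℕ × ℕ →₀ ℕ} (h : HasLead X γ) :
    RaisesBy X (expWeight γ) := fun v => by
  obtain ⟨c, -, hc⟩ := h v
  rw [← sub_add_cancel (X (Finsupp.single v 1)) (Finsupp.single (v + γ) c)]
  exact add_mem (weightFilt_anti (Nat.le_succ _) hc) (single_mem_weightFilt (by rw [map_add]) c)

theorem HasLead.add {X Y : Module.End K PolySpace} {γ : ℕ × ℕ →₀ ℕ} (hX : HasLead X γ)
    (hY : RaisesBy Y (expWeight γ + 1)) : HasLead (X + Y) γ := fun v => by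
  obtain ⟨c, hc0, hc⟩ := hX v
  refine ⟨c, hc0, ?_⟩
  rw [LinearMap.add_apply, add_sub_right_comm]
  exact add_mem hc (hY v)

theorem HasLead.mul {X Y : Module.End K PolySpace} {γ δ : ℕ × ℕ →₀ ℕ} (hX : HasLead X γ)
    (hY : HasLead Y δ) : HasLead (X * Y) (γ + δ) := fun v => by
  obtain ⟨c, hc0, hc⟩ := hY v
  obtain ⟨b, hb0, hb⟩ := hX (v + δ)
  refine ⟨c * b, mul_ne_zero hc0 hb0, ?_⟩
  have h1 := hX.raisesBy.map_mem hc
  have h2 := Submodule.smul_mem _ c hb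
  rw [map_sub, ← mul_one c, ← smul_eq_mul, ← Finsupp.smul_single, map_smul] at h1
  rw [smul_sub, Finsupp.smul_single, smul_eq_mul, add_assoc v, add_comm δ γ] at h2
  rw [Module.End.mul_apply, ← sub_add_sub_cancel _ (c • X (Finsupp.single (v + δ) 1))]
  refine add_mem (weightFilt_anti ?_ h1) (weightFilt_anti ?_ h2) <;> simp only [map_add] <;> omega

theorem HasLead.one : HasLead 1 0 := fun v => ⟨1, one_ne_zero, by simp⟩

theorem HasLead.pow {X : Module.End K PolySpace} {γ : ℕ × ℕ →₀ ℕ} (h : HasLead X γ) (k : ℕ) :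
    HasLead (X ^ k) (k • γ) := by
  induction k with
  | zero => simpa using HasLead.one
  | succ k ih => rw [pow_succ, succ_nsmul]; exact ih.mul h

theorem HasLead.list_prod {ι : Type*} {l : List ι} {X : ι → Module.End K PolySpace}
    {γ : ι → ℕ × ℕ →₀ ℕ} (h : ∀ p ∈ l, HasLead (X p) (γ p)) :
    HasLead (l.map X).prod (l.map γ).sum := by
  induction l with
  | nil => exact HasLead.one
  | cons p l ih =>
    simp only [List.map_cons, List.prod_cons, List.sum_cons]
    exact (h p (by simp)).mul (ih fun p hp => h p (by simp [hp]))

theorem HasLead.sum {ι : Type*} [Fintype ι] {f : ι → Module.End K PolySpace} {γ : ℕ × ℕ →₀ ℕ}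
    (i : ι) (hi : HasLead (f i) γ) (h : ∀ k, k ≠ i → RaisesBy (f k) (expWeight γ + 1)) :
    HasLead (∑ k, f k) γ := by
  classical
  rw [← Finset.add_sum_erase _ _ (Finset.mem_univ i)]
  exact hi.add (RaisesBy.sum fun k hk => h k (Finset.ne_of_mem_erase hk))

theorem linearIndependent_of_hasLead {ι : Type*} {X : ι → Module.End K PolySpace}
    {γ : ι → ℕ × ℕ →₀ ℕ} (hγ : Function.Injective γ) (h : ∀ m, HasLead (X m) (γ m)) :
    LinearIndependent K fun i => X i (Finsupp.single 0 1) := by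
  classical
  refine linearIndependent_iff'.mpr fun s g hs => ?_
  by_contra! hne
  obtain ⟨i₀, hi₀, hg₀⟩ := hne
  obtain ⟨i, hi, hmin⟩ := Finset.exists_min_image (s.filter fun i => g i ≠ 0)
    (fun i => expWeight (γ i)) ⟨i₀, by simp [hi₀, hg₀]⟩
  rw [Finset.mem_filter] at hi
  have heval := DFunLike.congr_fun hs (γ i)
  rw [Finsupp.finsetSum_apply, Finset.sum_eq_single_of_mem i hi.1] at heval
  · obtain ⟨c, hc0, hc⟩ := h i 0
    have := apply_eq_zero_of_mem_weightFilt hc (u := γ i) (by simp)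
    rw [Finsupp.sub_apply, zero_add, Finsupp.single_eq_same, sub_eq_zero] at this
    simp [this, hc0, hi.2] at heval
  · intro k hk hki
    rcases eq_or_ne (g k) 0 with h0 | h0
    · simp [h0]
    · obtain ⟨c, hc0, hc⟩ := h k 0
      have hle := hmin k (by simp [hk, h0])
      have := apply_eq_zero_of_mem_weightFilt hc (u := γ i)
        (by simp only [map_zero, zero_add]; omega)
      rw [Finsupp.sub_apply, zero_add, Finsupp.single_eq_of_ne (hγ.ne hki.symm), sub_zero] at this
      simp [this]

theorem hasLead_monoOp {γ : ℕ × ℕ →₀ ℕ} {f : (ℕ × ℕ →₀ ℕ) → K} (hf : ∀ v, f v ≠ 0) :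
    HasLead (monoOp γ f) γ := fun v => ⟨f v, hf v, by simp [monoOp_single]⟩

theorem hasLead_diagOp (a i : ℕ) : HasLead (diagOp a i) 0 :=
  hasLead_monoOp fun _ => zpow_ne_zero _ q_ne_zero

theorem hasLead_subOp (a i : ℕ) : HasLead (subOp a i) (Finsupp.single (a, i) 1) :=
  hasLead_monoOp fun _ => one_ne_zero

/-- The leading exponent of the `(i, j)` entry of `triangular`. -/
def entryExp (i j : ℕ) : ℕ × ℕ →₀ ℕ :=
  Finsupp.single (0, i) 1 + ∑ a ∈ Finset.range (i - j), Finsupp.single (a + 1, i - a) 1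

theorem expWeight_entryExp (i j : ℕ) :
    expWeight (entryExp i j) = ∑ a ∈ Finset.range (i - j), (a + 1) := by
  simp [entryExp, Finsupp.weight_single]

theorem triangular_eq_zero {n N : ℕ} {i j : Fin n} (h : i.val < j ∨ j + N < i.val) :
    triangular n N i j = 0 := by
  induction N generalizing j with
  | zero =>
    have : i ≠ j := by rintro rfl; omega
    simp [triangular, scaling, this]
  | succ N ih =>
    rw [triangular, Matrix.mul_apply]
    refine Finset.sum_eq_zero fun k _ => ?_
    by_cases hk : k = j ∨ k.val = j + 1
    · rw [ih (by rcases hk with rfl | hk <;> omega), zero_mul]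
    · push Not at hk
      simp [bidiagonal, hk.1, hk.2]

theorem hasLead_triangular {n N : ℕ} {i j : Fin n} (hji : j.val ≤ i) (hN : i.val ≤ j + N) :
    HasLead (triangular n N i j) (entryExp i j) := by
  induction N generalizing j with
  | zero =>
    obtain rfl : i = j := Fin.ext (by omega)
    simpa [triangular, scaling, entryExp] using hasLead_monoOp fun _ => one_ne_zero
  | succ N ih =>
    rw [triangular, Matrix.mul_apply]
    rcases hN.lt_or_eq with hlt | heq
    · refine HasLead.sum j ?_ fun k hk => ?_
      · simpa [bidiagonal] using (ih hji (by omega)).mul (hasLead_diagOp (N + 1) j)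
      · by_cases hkj : k.val = j + 1
        · rcases lt_or_ge i.val k with hik | hki
          · rw [triangular_eq_zero (Or.inl hik), zero_mul]; exact .zero _
          · have := (ih hki (by omega)).raisesBy.mul (hasLead_subOp (N + 1) k).raisesBy
            simp only [bidiagonal, hk, hkj, if_true, if_false]
            rw [hkj] at this
            refine this.mono ?_
            rw [expWeight_entryExp, expWeight_entryExp, Finsupp.weight_single,
              show i.val - j = (i - (j + 1)) + 1 by omega, Finset.sum_range_succ]
            simp only [smul_eq_mul, one_mul]
            omega
        · simp only [bidiagonal, hk, hkj, if_false, mul_zero]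
          exact .zero _
    · refine HasLead.sum ⟨j + 1, by omega⟩ ?_ fun k hk => ?_
      · have := (ih (j := ⟨j + 1, by omega⟩) (by simp only; omega) (by simp only; omega)).mul
          (hasLead_subOp (N + 1) (j + 1))
        have hexp : entryExp i j =
            entryExp i (j + 1) + Finsupp.single (N + 1, j.val + 1) 1 := by
          rw [entryExp, entryExp, show i.val - j = (i - (j + 1)) + 1 by omega,
            Finset.sum_range_succ, ← add_assoc]
          congr 3 <;> omega
        rw [hexp]
        simpa [bidiagonal, Fin.ext_iff] using this
      · by_cases hkj : k = j
        · rw [triangular_eq_zero (Or.inr (by omega)), zero_mul]; exact .zero _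
        · have : k.val ≠ j + 1 := fun h => hk (Fin.ext h)
          simp only [bidiagonal, hkj, this, if_false, mul_zero]
          exact .zero _

/-- The image of the generators `x_{ij}` in the representation. -/
def symOp (n : ℕ) : Matrix (Fin n) (Fin n) (Module.End K PolySpace) :=
  triangular n n * (triangular n n).transpose

theorem hasLead_symOp {n : ℕ} {i j : Fin n} (hij : i ≤ j) :
    HasLead (symOp n i j) (entryExp i i + entryExp j i) := by
  have lead : ∀ {i j : Fin n}, j ≤ i → HasLead (triangular n n i j) (entryExp i j) :=
    fun h => hasLead_triangular h (by omega)
  rw [symOp, Matrix.mul_apply]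
  refine HasLead.sum i ((lead le_rfl).mul (lead hij)) fun k hk => ?_
  rw [Matrix.transpose_apply]
  rcases lt_or_gt_of_ne hk with hki | hik
  · refine ((lead hki.le).raisesBy.mul (lead (hki.le.trans hij)).raisesBy).mono ?_
    rw [map_add]
    simp only [expWeight_entryExp]
    have hmono : ∑ a ∈ Finset.range (j.val - i), (a + 1) ≤ ∑ a ∈ Finset.range (j.val - k), (a + 1) :=
      Finset.sum_le_sum_of_subset (Finset.range_mono (by omega))
    have hpos : 1 ≤ ∑ a ∈ Finset.range (i.val - k), (a + 1) := by
      rw [show i.val - k = (i - k - 1) + 1 by omega, Finset.sum_range_succ]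
      omega
    simp only [Nat.sub_self, Finset.range_zero, Finset.sum_empty]
    omega
  · rw [triangular_eq_zero (Or.inl hik), zero_mul]; exact .zero _

end Representation

/-- The exponent of `x_{ij}`. -/
def genExp {n : ℕ} (p : Fin n × Fin n) : ℕ × ℕ →₀ ℕ :=
  entryExp p.1 p.1 + entryExp p.2 p.1

theorem entryExp_succ_apply (i j a b : ℕ) :
    entryExp i j (a + 1, b) = if i = a + b ∧ j < b then 1 else 0 := by
  have : ∀ x, (Finsupp.single (x + 1, i - x) 1 : ℕ × ℕ →₀ ℕ) (a + 1, b) =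
      if x = a then (if i - a = b then 1 else 0) else 0 := fun x => by
    rw [Finsupp.single_apply]
    by_cases h : x = a <;> simp [h]
  rw [entryExp, Finsupp.add_apply, Finsupp.finsetSum_apply]
  simp only [this, Finset.sum_ite_eq', Finset.mem_range]
  rw [Finsupp.single_eq_of_ne (by simp), zero_add, ← ite_and]
  exact if_congr (by omega) rfl rfl

theorem entryExp_zero_apply (i j b : ℕ) : entryExp i j (0, b) = if i = b then 1 else 0 := by
  rw [entryExp, Finsupp.add_apply, Finsupp.finsetSum_apply,
    Finset.sum_eq_zero fun a _ => Finsupp.single_eq_of_ne (by simp), Finsupp.single_apply]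
  simp

theorem genExp_linearIndependent {n : ℕ} (δ : Fin n × Fin n → ℤ) (hlow : ∀ p, ¬ p.1 ≤ p.2 → δ p = 0)
    (h : ∀ u, ∑ p, δ p * (genExp p u : ℤ) = 0) : δ = 0 := by
  have off : ∀ i j : Fin n, i < j → δ (i, j) = 0 := fun i j hij => by
    have h1 := h ((j - i - 1) + 1, i + 1)
    have h2 := h ((j - i) + 1, i)
    rw [← sub_eq_zero.mpr (h1.trans h2.symm), ← Finset.sum_sub_distrib,
      Finset.sum_eq_single_of_mem (i, j) (Finset.mem_univ _)]
    · simp only [genExp, Finsupp.add_apply, entryExp_succ_apply]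
      rw [if_neg (by omega), if_pos (by omega), if_neg (by omega), if_neg (by omega)]
      simp
    · rintro ⟨k, l⟩ - hne
      by_cases hkl : k ≤ l
      · rw [← mul_sub]
        simp only [genExp, Finsupp.add_apply, entryExp_succ_apply]
        have : ¬ (k.val = i ∧ l.val = j) := fun e => hne (Prod.ext (Fin.ext e.1) (Fin.ext e.2))
        have e : (l.val = j - i - 1 + (i + 1) ∧ k.val < i + 1) ↔ (l.val = j - i + i ∧ k.val < i) := by
          omega
        have e₁ : ¬ (k.val = j - i - 1 + (i + 1) ∧ k.val < i + 1) := by omega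
        have e₂ : ¬ (k.val = j - i + i ∧ k.val < i) := by omega
        simp only [e, e₁, e₂, sub_self, mul_zero, if_false]
      · simp [hlow (k, l) hkl]
  funext ⟨i, j⟩
  rcases lt_trichotomy i j with hij | rfl | hij
  · exact off i j hij
  · have h1 := h (0, i)
    rw [Finset.sum_eq_single_of_mem (i, i) (Finset.mem_univ _)] at h1
    · simpa [genExp, entryExp_zero_apply] using h1
    · rintro ⟨k, l⟩ - hne
      rcases lt_trichotomy k l with hkl | rfl | hkl
      · simp [off k l hkl]
      · have : k.val ≠ i := fun e => hne (by rw [Fin.ext e])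
        simp [genExp, entryExp_zero_apply, this]
      · simp [hlow (k, l) hkl.not_ge]
  · exact hlow (i, j) hij.not_ge

theorem mem_pairListAI {n : ℕ} {p : Fin n × Fin n} : p ∈ pairListAI n ↔ p.1 ≤ p.2 := by
  obtain ⟨i, j⟩ := p
  simp [pairListAI]

theorem pairwise_pairListAI (n : ℕ) :
    (pairListAI n).Pairwise fun a b => toLex a < toLex b := by
  rw [pairListAI, List.pairwise_flatMap]
  constructor
  · intro i _
    rw [List.pairwise_map]
    refine List.Pairwise.filter _ ((List.pairwise_lt_finRange n).imp fun h => ?_)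
    exact Prod.Lex.toLex_lt_toLex.mpr (Or.inr ⟨rfl, h⟩)
  · refine (List.pairwise_lt_finRange n).imp fun h => ?_
    intro x hx y hy
    obtain ⟨_, -, rfl⟩ := List.mem_map.mp hx
    obtain ⟨_, -, rfl⟩ := List.mem_map.mp hy
    exact Prod.Lex.toLex_lt_toLex.mpr (Or.inl h)

theorem nodup_pairListAI (n : ℕ) : (pairListAI n).Nodup :=
  (pairwise_pairListAI n).imp fun h e => by simp [e] at h

/-- The exponents `m`, extended by zero to all pairs of indices. -/
def extendExp {n : ℕ} (m : {p : Fin n × Fin n // p.1 ≤ p.2} → ℕ) (p : Fin n × Fin n) : ℕ :=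
  if h : p.1 ≤ p.2 then m ⟨p, h⟩ else 0

theorem injective_monomialExp (n : ℕ) :
    Function.Injective fun m : {p : Fin n × Fin n // p.1 ≤ p.2} → ℕ =>
      ((pairListAI n).map fun p => extendExp m p • genExp p).sum := by
  classical
  intro m m' hmm
  have hsum : ∀ (m : {p : Fin n × Fin n // p.1 ≤ p.2} → ℕ),
      ((pairListAI n).map fun p => extendExp m p • genExp p).sum =
        ∑ p, extendExp m p • genExp p := fun m => by
    rw [← List.sum_toFinset _ (nodup_pairListAI n)]
    refine Finset.sum_subset (Finset.subset_univ _) fun p _ hp => ?_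
    rw [List.mem_toFinset, mem_pairListAI] at hp
    simp [extendExp, hp]
  simp only [hsum] at hmm
  have key := genExp_linearIndependent (fun p => (extendExp m p : ℤ) - extendExp m' p)
    (fun p hp => by simp [extendExp, hp]) fun u => by
      have := congrArg (fun x : ℕ => (x : ℤ)) (DFunLike.congr_fun hmm u)
      simp only [Finsupp.finsetSum_apply, Finsupp.smul_apply, smul_eq_mul, Nat.cast_sum,
        Nat.cast_mul] at this
      simp only [sub_mul, Finset.sum_sub_distrib, this, sub_self]
  funext p
  have := congrFun key p.1
  simpa [extendExp, p.2, sub_eq_zero] using this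

theorem isQMatrix_tGen (n : ℕ) : IsQMatrix (Matrix.of fun i j : Fin n => tGen i j) := by
  refine .of_relations ?_ ?_ ?_ ?_
  · intro l i j h
    simpa [tGen] using RingQuot.mkAlgHom_rel K (matRel.rowq l i j h)
  · intro l i j h
    simpa [tGen] using RingQuot.mkAlgHom_rel K (matRel.colq l i j h)
  · intro i k j l h1 h2
    simpa [tGen] using RingQuot.mkAlgHom_rel K (matRel.anti i k j l h1 h2)
  · intro i k j l h1 h2
    simpa [tGen] using RingQuot.mkAlgHom_rel K (matRel.main i k j l h1 h2)

/-- A quantum matrix with entries in `A` is an algebra homomorphism from `𝒪_q(Mat_n)` to `A`. -/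
def IsQMatrix.lift {A : Type} [Ring A] [Algebra K A] {n : ℕ} {t : Matrix (Fin n) (Fin n) A}
    (h : IsQMatrix t) : OqMat n →ₐ[K] A :=
  RingQuot.liftAlgHom K ⟨FreeAlgebra.lift K fun p => t p.1 p.2, by
    rintro _ _ (⟨l, i, j, hij⟩ | ⟨l, i, j, hij⟩ | ⟨i, k, j, l, h1, h2⟩ | ⟨i, k, j, l, h1, h2⟩)
    · simpa [Tg] using h.row l i j hij
    · simpa [Tg] using h.col l i j hij
    · simpa [Tg] using h.anti i k j l h1 h2
    · simpa [Tg] using h.main i k j l h1 h2⟩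

theorem IsQMatrix.lift_tGen {A : Type} [Ring A] [Algebra K A] {n : ℕ}
    {t : Matrix (Fin n) (Fin n) A} (h : IsQMatrix t) (i j : Fin n) : h.lift (tGen i j) = t i j := by
  simp [IsQMatrix.lift, tGen, Tg]

theorem IsQMatrix.lift_xAI {A : Type} [Ring A] [Algebra K A] {n : ℕ}
    {t : Matrix (Fin n) (Fin n) A} (h : IsQMatrix t) (i j : Fin n) :
    h.lift (xAI i j) = (t * t.transpose) i j := by
  simp [xAI, Matrix.mul_apply, h.lift_tGen]

theorem linearIndependent_xAI_prod (n : ℕ) {E : List (Fin n × Fin n)} (hE : E.Perm (pairListAI n)) :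
    LinearIndependent K fun m : {p : Fin n × Fin n // p.1 ≤ p.2} → ℕ =>
      (E.map fun p => xAI p.1 p.2 ^ extendExp m p).prod := by
  have hT := isQMatrix_triangular n n
  have himg : ∀ m, hT.lift (E.map fun p => xAI p.1 p.2 ^ extendExp m p).prod =
      (E.map fun p => symOp n p.1 p.2 ^ extendExp m p).prod := fun m => by
    rw [map_list_prod, List.map_map]
    congr 1
    refine List.map_congr_left fun p _ => ?_
    simp [hT.lift_xAI, symOp]
  have hlead : ∀ m : {p : Fin n × Fin n // p.1 ≤ p.2} → ℕ,
      HasLead (E.map fun p => symOp n p.1 p.2 ^ extendExp m p).prod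
        ((pairListAI n).map fun p => extendExp m p • genExp p).sum := fun m => by
    rw [← (hE.map _).sum_eq]
    exact HasLead.list_prod fun p hp =>
      (hasLead_symOp (mem_pairListAI.mp (hE.mem_iff.mp hp))).pow _
  refine LinearIndependent.of_comp
    (LinearMap.applyₗ (Finsupp.single 0 1 : PolySpace) ∘ₗ hT.lift.toLinearMap) ?_
  convert linearIndependent_of_hasLead (injective_monomialExp n) hlead using 2 with m
  simp [himg]

theorem xAI_swap {n : ℕ} {i j : Fin n} (h : i < j) : xAI j i = q⁻¹ • xAI i j := by
  have ht := isQMatrix_tGen n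
  rw [eq_inv_smul_iff₀ q_ne_zero, xAI, xAI, Finset.smul_sum]
  exact Finset.sum_congr rfl fun k _ => (ht.col k i j h).symm

theorem exists_xAI_eq_smul {n : ℕ} (i j : Fin n) :
    ∃ (c : K) (p : {p : Fin n × Fin n // p.1 ≤ p.2}), xAI i j = c • xAI p.1.1 p.1.2 := by
  rcases le_or_gt i j with h | h
  · exact ⟨1, ⟨(i, j), h⟩, by simp⟩
  · exact ⟨q⁻¹, ⟨(j, i), h.le⟩, xAI_swap h⟩

theorem xAI_straighten {n : ℕ} {r p : {p : Fin n × Fin n // p.1 ≤ p.2}}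
    (h : toLex r.1 < toLex p.1) :
    ∃ c : K, c ≠ 0 ∧
      xAI p.1.1 p.1.2 * xAI r.1.1 r.1.2 - c • (xAI r.1.1 r.1.2 * xAI p.1.1 p.1.2) ∈
      Submodule.span K {y | ∃ a b : {p : Fin n × Fin n // p.1 ≤ p.2},
        (toLex r.1 < toLex a.1 ∧ toLex a.1 < toLex p.1) ∧
          xAI a.1.1 a.1.2 * xAI b.1.1 b.1.2 = y} := by
  obtain ⟨⟨k, l⟩, hkl⟩ := r
  obtain ⟨⟨i, j⟩, hij⟩ := p
  simp only at hkl hij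
  obtain ⟨c, α, β, hc, heq, hα, hβ⟩ := reflection_straighten (X := fun i j : Fin n => xAI i j)
    q_ne_zero (fun i j => xAI_swap) ((isQMatrix_tGen n).reflection_apply (by
      ext i j; simp [xAI, Matrix.mul_apply])) hij hkl (by
      simpa [Prod.Lex.toLex_lt_toLex] using h)
  refine ⟨c, hc, ?_⟩
  have mem : ∀ (s t u : Fin n), k < i → l < s → s ≤ j → i ≤ s →
      xAI k s * xAI t u ∈ Submodule.span K {y | ∃ a b : {p : Fin n × Fin n // p.1 ≤ p.2},
        (toLex (k, l) < toLex a.1 ∧ toLex a.1 < toLex (i, j)) ∧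
          xAI a.1.1 a.1.2 * xAI b.1.1 b.1.2 = y} := fun s t u hki hls hsj his => by
    obtain ⟨d, b, hb⟩ := exists_xAI_eq_smul t u
    rw [hb, mul_smul_comm]
    exact Submodule.smul_mem _ _ (Submodule.subset_span ⟨⟨(k, s), hki.le.trans his⟩, b,
      ⟨Prod.Lex.toLex_lt_toLex.mpr (Or.inr ⟨rfl, hls⟩),
        Prod.Lex.toLex_lt_toLex.mpr (Or.inl hki)⟩, rfl⟩)
  simp only at heq ⊢
  rw [heq, add_assoc, add_sub_cancel_left]
  refine add_mem ?_ ?_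
  · rcases eq_or_ne α 0 with h0 | h0
    · simp [h0]
    · exact Submodule.smul_mem _ _ (mem i j l (hα h0).1 (hα h0).2 hij le_rfl)
  · rcases eq_or_ne β 0 with h0 | h0
    · simp [h0]
    · exact Submodule.smul_mem _ _ (mem j i l (hβ h0).1 (hβ h0).2 le_rfl hij)

theorem span_xAI_prod {n : ℕ} {L : Type*} [LinearOrder L] [WellFoundedLT L]
    {ρ : Fin n × Fin n → L} (hρ : Function.Injective ρ)
    (hg : ∀ r p : {p : Fin n × Fin n // p.1 ≤ p.2}, ρ r.1 < ρ p.1 →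
      xAI p.1.1 p.1.2 * xAI r.1.1 r.1.2 ∈ Submodule.span K
        {y | ∃ a b : {p : Fin n × Fin n // p.1 ≤ p.2}, ρ a.1 < ρ p.1 ∧
          xAI a.1.1 a.1.2 * xAI b.1.1 b.1.2 = y})
    {E : List (Fin n × Fin n)} (hE : E.Pairwise fun a b => ρ a < ρ b)
    (hmem : ∀ p, p ∈ E ↔ p.1 ≤ p.2) :
    (Submodule.span K (Set.range fun m : {p : Fin n × Fin n // p.1 ≤ p.2} → ℕ =>
      (E.map fun p => xAI p.1 p.2 ^ extendExp m p).prod) : Set (OqMat n)) =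
      (Algebra.adjoin K {y : OqMat n | ∃ i j : Fin n, y = xAI i j} : Set (OqMat n)) := by
  set g : {p : Fin n × Fin n // p.1 ≤ p.2} → OqMat n := fun p => xAI p.1.1 p.1.2
  set E' := E.attachWith (fun p => p.1 ≤ p.2) fun p hp => (hmem p).mp hp
  have hE' : E'.map Subtype.val = E := List.attachWith_map_subtype_val _
  have hspan := span_monomials_eq_adjoin (F := K) (g := g) (hρ.comp Subtype.val_injective) hg
    (E := E') (by
      have := hE
      rwa [← hE', List.pairwise_map] at this)
    (fun p => by simp [E', hmem, p.2])
  have hmono : ∀ m : {p : Fin n × Fin n // p.1 ≤ p.2} → ℕ,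
      (E.map fun p => xAI p.1 p.2 ^ extendExp m p).prod = (E'.map fun p => g p ^ m p).prod :=
    fun m => by
      rw [← hE', List.map_map]
      congr 1
      refine List.map_congr_left fun p _ => ?_
      simp [g, extendExp, p.2]
  have hadj : Algebra.adjoin K (Set.range g) =
      Algebra.adjoin K {y : OqMat n | ∃ i j : Fin n, y = xAI i j} := by
    refine le_antisymm (Algebra.adjoin_mono ?_) (Algebra.adjoin_le ?_)
    · rintro _ ⟨p, rfl⟩
      exact ⟨_, _, rfl⟩
    · rintro _ ⟨i, j, rfl⟩
      obtain ⟨c, p, hp⟩ := exists_xAI_eq_smul i j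
      rw [hp]
      exact Subalgebra.smul_mem _ (Algebra.subset_adjoin (Set.mem_range_self p)) c
  simp only [hmono, hspan, hadj, Subalgebra.coe_toSubmodule]

theorem stmt10 (n : ℕ) :
    (LinearIndependent K fun m : {p : Fin n × Fin n // p.1 ≤ p.2} → ℕ => monoAI n m) ∧
    ((Submodule.span K (Set.range (monoAI n)) : Set (OqMat n)) =
      (Algebra.adjoin K {y : OqMat n | ∃ i j : Fin n, y = xAI i j} : Set (OqMat n))) ∧
    (LinearIndependent K fun m : {p : Fin n × Fin n // p.1 ≤ p.2} → ℕ => monoAIrev n m) ∧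
    ((Submodule.span K (Set.range (monoAIrev n)) : Set (OqMat n)) =
      (Algebra.adjoin K {y : OqMat n | ∃ i j : Fin n, y = xAI i j} : Set (OqMat n))) := by
  have hrev : (pairListAI n).reverse.Pairwise
      fun a b => OrderDual.toDual (toLex a) < OrderDual.toDual (toLex b) := by
    rw [List.pairwise_reverse]
    exact (pairwise_pairListAI n).imp fun h => h
  refine ⟨linearIndependent_xAI_prod n (.refl _),
    span_xAI_prod (ρ := toLex) toLex.injective (fun r p h => ?_) (pairwise_pairListAI n)
      fun _ => mem_pairListAI,
    linearIndependent_xAI_prod n (List.reverse_perm _),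
    span_xAI_prod (ρ := fun p => OrderDual.toDual (toLex p))
      (OrderDual.toDual.injective.comp toLex.injective) (fun r p h => ?_) hrev
      fun _ => List.mem_reverse.trans mem_pairListAI⟩
  · obtain ⟨c, -, hmem⟩ := xAI_straighten h
    rw [← sub_add_cancel (xAI p.1.1 p.1.2 * xAI r.1.1 r.1.2)
      (c • (xAI r.1.1 r.1.2 * xAI p.1.1 p.1.2))]
    refine add_mem (Submodule.span_mono ?_ hmem)
      (Submodule.smul_mem _ _ (Submodule.subset_span ⟨r, p, h, rfl⟩))
    rintro _ ⟨a, b, hab, rfl⟩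
    exact ⟨a, b, hab.2, rfl⟩
  · replace h : toLex p.1 < toLex r.1 := h
    obtain ⟨c, hc, hmem⟩ := xAI_straighten h
    rw [← inv_smul_smul₀ hc (xAI p.1.1 p.1.2 * xAI r.1.1 r.1.2),
      ← sub_sub_cancel (xAI r.1.1 r.1.2 * xAI p.1.1 p.1.2)
        (c • (xAI p.1.1 p.1.2 * xAI r.1.1 r.1.2))]
    refine Submodule.smul_mem _ _ (sub_mem (Submodule.subset_span ⟨r, p, h, rfl⟩)
      (Submodule.span_mono ?_ hmem))
    rintro _ ⟨a, b, hab, rfl⟩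
    exact ⟨a, b, hab.1, rfl⟩
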